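/- Let p be an odd prime with p ≡ 2 (mod 3), let a, b ∈ ℤ/p²ℤ, and set h := h(a,b). Assume h is not the identity matrix. Let M₂ := (ℤ/p²ℤ)² with h acting by matrix-vector multiplication. Then: (a) the image of the map v ↦ h·v − v on M₂ equals {v ∈ M₂ : p·v = 0}; (b) the kernel of the map v ↦ (1 + h + ⋯ + h^{p−1})·v equals {v ∈ M₂ : p·v = 0}; consequently (c) for every v ∈ M₂ with (1 + h + ⋯ + h^{p−1})·v = 0 there exists w ∈ M₂ with v = h·w − w (i.e., the first cohomology of the cyclic group generated by h with coefficients in M₂ vanishes). -/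

import Mathlib

/-- The matrix `h(a,b)` over `ℤ/p²ℤ`. -/
def hmat (p : ℕ) (a b : ZMod (p ^ 2)) : Matrix (Fin 2) (Fin 2) (ZMod (p ^ 2)) :=
  !![1 + (p : ZMod (p ^ 2)) * (a - 2 * b), 3 * (p : ZMod (p ^ 2)) * (b - a);
     -((p : ZMod (p ^ 2)) * b), 1 - (p : ZMod (p ^ 2)) * (a - 2 * b)]

/-- The form `x² - xy + y²` is anisotropic over `ℤ/pℤ` when `p ≡ 2 (mod 3)` is odd. -/
theorem ZMod.eq_zero_of_sq_sub_mul_add_sq_eq_zero {p : ℕ} [Fact p.Prime] (hodd : Odd p)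
    (hp3 : p % 3 = 2) {x y : ZMod p} (h : x ^ 2 - x * y + y ^ 2 = 0) : x = 0 ∧ y = 0 := by
  by_cases hx : x = 0
  · subst hx
    simpa using h
  by_cases hy : y = 0
  · subst hy
    simpa using h
  exfalso
  obtain ⟨m, hm⟩ := hodd
  obtain ⟨k, hk, hk'⟩ : ∃ k, p - 1 = 3 * k + 1 ∧ Odd k :=
    ⟨p / 3, by omega, Nat.odd_iff.2 (by omega)⟩
  have hx1 := ZMod.pow_card_sub_one_eq_one hx
  have hy1 := ZMod.pow_card_sub_one_eq_one hy
  rw [hk, pow_succ, pow_mul] at hx1 hy1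
  have h3 : x ^ 3 = -y ^ 3 := by linear_combination (x + y) * h
  rw [h3, hk'.neg_pow] at hx1
  have hxy : y = -x := by
    have hne : (y ^ 3) ^ k ≠ 0 := pow_ne_zero _ (pow_ne_zero _ hy)
    apply mul_left_cancel₀ hne
    linear_combination hy1 - hx1
  subst hxy
  have h0 : (3 : ZMod p) * x ^ 2 = 0 := by linear_combination h
  rcases mul_eq_zero.1 h0 with h0 | h0
  · have hdvd : p ∣ 3 := (ZMod.natCast_eq_zero_iff 3 p).1 (by exact_mod_cast h0)
    have := (Nat.prime_dvd_prime_iff_eq Fact.out Nat.prime_three).1 hdvd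
    omega
  · exact hx (pow_eq_zero_iff two_ne_zero |>.1 h0)

theorem ZMod.natCast_mul_self_sq (p : ℕ) : (p : ZMod (p ^ 2)) * p = 0 := by
  rw [← sq, ← Nat.cast_pow, ZMod.natCast_self]

theorem ZMod.natCast_mul_eq_zero_iff_dvd {p : ℕ} [Fact p.Prime] (z : ZMod (p ^ 2)) :
    (p : ZMod (p ^ 2)) * z = 0 ↔ (p : ZMod (p ^ 2)) ∣ z := by
  constructor
  · intro h
    have hp : 0 < p := (Fact.out : p.Prime).pos
    rw [← ZMod.natCast_zmod_val z, ← Nat.cast_mul, ZMod.natCast_eq_zero_iff] at h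
    have h' : p * p ∣ p * z.val := sq p ▸ h
    rw [← ZMod.natCast_zmod_val z]
    exact Nat.cast_dvd_cast (Nat.dvd_of_mul_dvd_mul_left hp h')
  · rintro ⟨w, rfl⟩
    rw [← mul_assoc, ZMod.natCast_mul_self_sq, zero_mul]

theorem ZMod.dvd_of_castHom_eq_zero {p : ℕ} [Fact p.Prime] {z : ZMod (p ^ 2)}
    (h : ZMod.castHom (dvd_pow_self p two_ne_zero) (ZMod p) z = 0) :
    (p : ZMod (p ^ 2)) ∣ z := by
  rw [← ZMod.natCast_zmod_val z, map_natCast, ZMod.natCast_eq_zero_iff] at h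
  rw [← ZMod.natCast_zmod_val z]
  exact Nat.cast_dvd_cast h

theorem ZMod.isUnit_of_castHom_ne_zero {p : ℕ} [Fact p.Prime] {z : ZMod (p ^ 2)}
    (h : ZMod.castHom (dvd_pow_self p two_ne_zero) (ZMod p) z ≠ 0) : IsUnit z := by
  rw [← ZMod.natCast_zmod_val z, map_natCast, Ne, ZMod.natCast_eq_zero_iff] at h
  rw [← ZMod.natCast_zmod_val z, ZMod.isUnit_iff_coprime]
  exact (((Fact.out : p.Prime).coprime_iff_not_dvd.2 h).symm).pow_right 2

/-- If `h(a,b) ≠ 1`, then `a² - ab + b²` is a unit. -/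
theorem isUnit_of_hmat_ne_one {p : ℕ} [Fact p.Prime] (hodd : Odd p) (hp3 : p % 3 = 2)
    {a b : ZMod (p ^ 2)} (hne : hmat p a b ≠ 1) : IsUnit (a ^ 2 - a * b + b ^ 2) := by
  apply ZMod.isUnit_of_castHom_ne_zero
  intro h0
  apply hne
  simp only [map_add, map_sub, map_mul, map_pow] at h0
  obtain ⟨ha, hb⟩ := ZMod.eq_zero_of_sq_sub_mul_add_sq_eq_zero hodd hp3 h0
  replace ha := (ZMod.natCast_mul_eq_zero_iff_dvd a).2 (ZMod.dvd_of_castHom_eq_zero ha)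
  replace hb := (ZMod.natCast_mul_eq_zero_iff_dvd b).2 (ZMod.dvd_of_castHom_eq_zero hb)
  ext i j
  fin_cases i <;> fin_cases j <;> simp [hmat]
  · linear_combination ha - 2 * hb
  · linear_combination 3 * hb - 3 * ha
  · exact hb
  · linear_combination ha - 2 * hb

/-- If `n² = 0` and `p n = 0` with `p` odd, then `1 + (1 + n) + ⋯ + (1 + n)^{p-1} = p`. -/
theorem sum_range_one_add_pow_of_sq_eq_zero {R : Type*} [Ring R] {n : R} (hn : n * n = 0)
    {p : ℕ} (hodd : Odd p) (hpn : (p : R) * n = 0) :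
    ∑ i ∈ Finset.range p, (1 + n) ^ i = p := by
  have hpow (i : ℕ) : (1 + n) ^ i = 1 + i * n := by
    induction i with
    | zero => simp
    | succ i ih =>
      rw [pow_succ, ih, add_mul, one_mul, mul_add, mul_one, mul_assoc, hn]
      push_cast
      noncomm_ring
  obtain ⟨m, rfl⟩ := hodd
  have hsum : ∑ i ∈ Finset.range (2 * m + 1), i = m * (2 * m + 1) := by
    have := Finset.sum_range_id_mul_two (2 * m + 1)
    rw [Nat.add_sub_cancel] at this
    linarith
  simp only [hpow, Finset.sum_add_distrib, ← Finset.sum_mul]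
  rw [← Nat.cast_sum, hsum, Nat.cast_mul, mul_assoc, hpn]
  simp

theorem sum_range_hmat_pow {p : ℕ} (hodd : Odd p) (a b : ZMod (p ^ 2)) :
    ∑ i ∈ Finset.range p, hmat p a b ^ i = (p : Matrix (Fin 2) (Fin 2) (ZMod (p ^ 2))) := by
  have hpp := ZMod.natCast_mul_self_sq p
  set N : Matrix (Fin 2) (Fin 2) (ZMod (p ^ 2)) :=
    !![a - 2 * b, 3 * (b - a); -b, -(a - 2 * b)] with hN
  have hh : hmat p a b = 1 + (p : ZMod (p ^ 2)) • N := by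
    ext i j
    fin_cases i <;> fin_cases j <;> simp [hmat, hN] <;> ring
  rw [hh]
  apply sum_range_one_add_pow_of_sq_eq_zero _ hodd
  · rw [← nsmul_eq_mul, ← Nat.cast_smul_eq_nsmul (ZMod (p ^ 2)), smul_smul, hpp, zero_smul]
  · rw [Matrix.smul_mul, Matrix.mul_smul, smul_smul, hpp, zero_smul]

/-- Over `ℤ/p²ℤ`, the image of `h(a,b) - 1` is the `p`-torsion. -/
theorem range_hmat_mulVec_sub {p : ℕ} [Fact p.Prime] (hodd : Odd p) (hp3 : p % 3 = 2)
    {a b : ZMod (p ^ 2)} (hne : hmat p a b ≠ 1) :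
    Set.range (fun v : Fin 2 → ZMod (p ^ 2) => (hmat p a b).mulVec v - v)
      = {v : Fin 2 → ZMod (p ^ 2) | (p : ZMod (p ^ 2)) • v = 0} := by
  have hpp := ZMod.natCast_mul_self_sq p
  ext v
  constructor
  · rintro ⟨w, rfl⟩
    ext i
    fin_cases i
    · simp [hmat, Matrix.vecHead, Matrix.vecTail]
      linear_combination ((a - 2 * b) * w 0 + 3 * (b - a) * w 1) * hpp
    · simp [hmat, Matrix.vecHead, Matrix.vecTail]
      linear_combination (-b * w 0 - (a - 2 * b) * w 1) * hpp
  · intro hv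
    obtain ⟨x, hx⟩ := (ZMod.natCast_mul_eq_zero_iff_dvd (v 0)).1 (congrFun hv 0)
    obtain ⟨y, hy⟩ := (ZMod.natCast_mul_eq_zero_iff_dvd (v 1)).1 (congrFun hv 1)
    obtain ⟨u, hu⟩ := (isUnit_of_hmat_ne_one hodd hp3 hne).exists_right_inv
    refine ⟨![u * ((a - 2 * b) * x + 3 * (b - a) * y), u * (-b * x - (a - 2 * b) * y)], ?_⟩
    ext i
    fin_cases i
    · simp [hmat, hx]
      linear_combination p * x * hu
    · simp [hmat, hy]
      linear_combination p * y * hu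

/-- **(end of the proof of Lemma 3.2).** For `h = h(a,b) ≠ 1` acting on
`M₂ = (ℤ/p²ℤ)²`: (a) the image of `v ↦ h·v − v` is `M₂[p]`; (b) the kernel of
the norm map `v ↦ (1 + h + ⋯ + h^{p−1})·v` is `M₂[p]`; hence (c)
`H¹(⟨h⟩, M₂) = 0`: every `v` killed by the norm is of the form `h·w − w`. -/
theorem H1_cyclic_h_vanishes (p : ℕ) [Fact p.Prime] (hodd : Odd p)
    (hp3 : p % 3 = 2) (a b : ZMod (p ^ 2)) (hne : hmat p a b ≠ 1) :
    (Set.range (fun v : Fin 2 → ZMod (p ^ 2) => (hmat p a b).mulVec v - v)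
      = {v : Fin 2 → ZMod (p ^ 2) | (p : ZMod (p ^ 2)) • v = 0}) ∧
    ({v : Fin 2 → ZMod (p ^ 2) |
        (∑ i ∈ Finset.range p, hmat p a b ^ i).mulVec v = 0}
      = {v : Fin 2 → ZMod (p ^ 2) | (p : ZMod (p ^ 2)) • v = 0}) ∧
    (∀ v : Fin 2 → ZMod (p ^ 2),
      (∑ i ∈ Finset.range p, hmat p a b ^ i).mulVec v = 0 →
      ∃ w : Fin 2 → ZMod (p ^ 2), v = (hmat p a b).mulVec w - w) := by
  have hrange := range_hmat_mulVec_sub hodd hp3 hne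
  have hker (v : Fin 2 → ZMod (p ^ 2)) :
      (∑ i ∈ Finset.range p, hmat p a b ^ i).mulVec v = (p : ZMod (p ^ 2)) • v := by
    rw [sum_range_hmat_pow hodd, Matrix.natCast_mulVec]
  refine ⟨hrange, by simp only [hker], fun v hv => ?_⟩
  rw [hker] at hv
  obtain ⟨w, hw⟩ := hrange.ge hv
  exact ⟨w, hw.symm⟩
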